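/- With the Calderón–Zygmund decomposition as in the context, fix an integer s ≥ 200 and w ∈ {0,1/2}^d. Then there is a constant C' depending only on d and the constants C, c₁, c₂ such that Σ |K| ≤ C' 2^{ds} λ^{−1} C_Ω ‖f‖_{L¹(ℝ^d)}, where the sum runs over all K ∈ 𝔇^w such that b_{k−s}·χ_{½K} is not almost everywhere zero, and k = k(K) is the integer with l(K) = 2^k. -/

import Mathlib

open MeasureTheory Metric Set FourierTransform
open scoped ENNReal RealInnerProductSpace

noncomputable section

abbrev Rd (d : ℕ) : Type := EuclideanSpace ℝ (Fin d)

/-- The dyadic cube `2^k w + ∏_i [m_i 2^k, (m_i+1) 2^k)` in the shifted grid `𝔇^w`. -/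
def dcube (d : ℕ) (w : Fin d → ℝ) (k : ℤ) (m : Fin d → ℤ) : Set (Rd d) :=
  {x | ∀ i : Fin d, (2:ℝ) ^ k * (w i + m i) ≤ x i ∧ x i < (2:ℝ) ^ k * (w i + m i + 1)}

/-- The concentric cube `½K` of half the sidelength. -/
def dhalf (d : ℕ) (w : Fin d → ℝ) (k : ℤ) (m : Fin d → ℤ) : Set (Rd d) :=
  {x | ∀ i : Fin d,
    (2:ℝ) ^ k * (w i + m i + 1/4) ≤ x i ∧ x i < (2:ℝ) ^ k * (w i + m i + 3/4)}

/-- `w ∈ {0, 1/2}^d`. -/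
def GridShift (d : ℕ) (w : Fin d → ℝ) : Prop := ∀ i, w i = 0 ∨ w i = 1/2

/-- The Calderón–Zygmund decomposition data at level `λ/C_Ω`: a countable collection
`Qset` of pairwise disjoint standard dyadic cubes and bad functions `b_Q` with
`supp b_Q ⊆ Q`, `∫ b_Q = 0`, `‖b_Q‖₁ ≤ C⟨f⟩_Q |Q|` and `⟨f⟩_Q ≈ λ/C_Ω`. -/
structure CZData (d : ℕ) (COm Cc c₁ c₂ : ℝ) (f : Rd d → ℝ) (lam : ℝ)
    (Qset : Set (ℤ × (Fin d → ℤ))) (b : ℤ × (Fin d → ℤ) → Rd d → ℝ) : Prop where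
  pairwise_disjoint : Qset.Pairwise fun q q' =>
    Disjoint (dcube d 0 q.1 q.2) (dcube d 0 q'.1 q'.2)
  support_subset : ∀ q ∈ Qset, Function.support (b q) ⊆ dcube d 0 q.1 q.2
  integrable : ∀ q ∈ Qset, Integrable (b q)
  integral_zero : ∀ q ∈ Qset, (∫ x, b q x) = 0
  l1_bound : ∀ q ∈ Qset, (∫ x, |b q x|) ≤ Cc * ∫ x in dcube d 0 q.1 q.2, |f x|
  avg_lower : ∀ q ∈ Qset, c₁ * lam / COm ≤
    (∫ x in dcube d 0 q.1 q.2, |f x|) / (volume (dcube d 0 q.1 q.2)).toReal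
  avg_upper : ∀ q ∈ Qset,
    (∫ x in dcube d 0 q.1 q.2, |f x|) / (volume (dcube d 0 q.1 q.2)).toReal ≤ c₂ * lam / COm

/-- `b_m = Σ_{Q ∈ 𝒬, l(Q) = 2^m} b_Q`. -/
def bsum (d : ℕ) (Qset : Set (ℤ × (Fin d → ℤ))) (b : ℤ × (Fin d → ℤ) → Rd d → ℝ)
    (m : ℤ) (x : Rd d) : ℝ :=
  ∑' mv : Fin d → ℤ, Set.indicator Qset (fun q => b q x) (m, mv)

theorem dcube_eq_preimage (d : ℕ) (w : Fin d → ℝ) (k : ℤ) (m : Fin d → ℤ) :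
    dcube d w k m = (MeasurableEquiv.toLp 2 (Fin d → ℝ)).symm ⁻¹'
      (Set.univ.pi fun i => Ico ((2:ℝ) ^ k * (w i + m i)) ((2:ℝ) ^ k * (w i + m i + 1))) := by
  ext x
  simp [dcube, Set.mem_pi]

theorem measurableSet_dcube (d : ℕ) (w : Fin d → ℝ) (k : ℤ) (m : Fin d → ℤ) :
    MeasurableSet (dcube d w k m) := by
  rw [dcube_eq_preimage]
  exact (MeasurableEquiv.measurable _) (MeasurableSet.univ_pi fun _ => measurableSet_Ico)

theorem volume_dcube (d : ℕ) (w : Fin d → ℝ) (k : ℤ) (m : Fin d → ℤ) :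
    volume (dcube d w k m) = ENNReal.ofReal (((2:ℝ) ^ k) ^ d) := by
  rw [dcube_eq_preimage,
    (EuclideanSpace.volume_preserving_symm_measurableEquiv_toLp (Fin d)).measure_preimage
      (MeasurableSet.univ_pi fun _ => measurableSet_Ico).nullMeasurableSet, Real.volume_pi_Ico,
    ← ENNReal.ofReal_prod_of_nonneg]
  · congr 1
    rw [Finset.prod_congr rfl (g := fun _ => (2:ℝ) ^ k) (fun i _ => by ring)]
    simp
  · intro i _
    have : (0:ℝ) < 2 ^ k := by positivity
    nlinarith

/-- A cube on whose concentric half `b_j` does not vanish has a selected cube of side `2^j`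
meeting that half. -/
theorem exists_mem_dcube_inter_dhalf {d : ℕ} {COm Cc c₁ c₂ : ℝ} {f : Rd d → ℝ} {lam : ℝ}
    {Qset : Set (ℤ × (Fin d → ℤ))} {b : ℤ × (Fin d → ℤ) → Rd d → ℝ}
    (h : CZData d COm Cc c₁ c₂ f lam Qset b) {w : Fin d → ℝ} {k j : ℤ} {m : Fin d → ℤ}
    (hK : ¬ ((dhalf d w k m).indicator (bsum d Qset b j)
      =ᵐ[(volume : Measure (Rd d))] (fun _ => (0:ℝ)))) :
    ∃ n : Fin d → ℤ, (j, n) ∈ Qset ∧ (dcube d 0 j n ∩ dhalf d w k m).Nonempty := by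
  by_contra! hne
  refine hK (Filter.Eventually.of_forall fun x => Set.indicator_apply_eq_zero.2 fun hx => ?_)
  refine (tsum_congr fun n => ?_).trans tsum_zero
  refine Set.indicator_apply_eq_zero.2 fun hn => ?_
  by_contra hb
  have hmem : x ∈ dcube d 0 j n ∩ dhalf d w k m := ⟨h.support_subset _ hn hb, hx⟩
  rw [hne n hn] at hmem
  exact hmem

/-- A small dyadic cube meets the concentric half of at most one cube of a given generation. -/
theorem eq_of_dcube_inter_dhalf_nonempty {d : ℕ} {w : Fin d → ℝ} {k : ℤ} {s : ℕ} (hs : 1 ≤ s)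
    {n m m' : Fin d → ℤ} (h : (dcube d 0 (k - s) n ∩ dhalf d w k m).Nonempty)
    (h' : (dcube d 0 (k - s) n ∩ dhalf d w k m').Nonempty) : m = m' := by
  have key : ∀ {m m' : Fin d → ℤ}, (dcube d 0 (k - s) n ∩ dhalf d w k m).Nonempty →
      (dcube d 0 (k - s) n ∩ dhalf d w k m').Nonempty → ∀ i, m' i ≤ m i := by
    rintro m m' ⟨x, hx, hxm⟩ ⟨y, hy, hym⟩ i
    by_contra! hlt
    have hlt' : (m i : ℝ) + 1 ≤ m' i := by exact_mod_cast hlt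
    have h1 := (hx i).1
    have h2 := (hxm i).2
    have h3 := (hy i).2
    have h4 := (hym i).1
    have hT : (0:ℝ) < 2 ^ (k - s) := by positivity
    have hkk : (2:ℝ) ^ (k - s) * 2 ^ s = 2 ^ k := by
      rw [← zpow_natCast, ← zpow_add₀ two_ne_zero, sub_add_cancel]
    have h2s : (2:ℝ) ≤ 2 ^ s := by
      simpa using pow_le_pow_right₀ (one_le_two (α := ℝ)) hs
    simp only [Pi.zero_apply, zero_add] at h1 h3
    have hk : (2:ℝ) * 2 ^ (k - s) ≤ 2 ^ k := by nlinarith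
    nlinarith [mul_le_mul_of_nonneg_left hlt' (by linarith : (0:ℝ) ≤ 2 ^ k)]
  exact funext fun i => le_antisymm (key h' h i) (key h h' i)

/-- The lower bound on averages controls the measure of a selected cube. -/
theorem volume_dcube_le_lintegral {d : ℕ} {COm Cc c₁ c₂ : ℝ} {f : Rd d → ℝ} {lam : ℝ}
    {Qset : Set (ℤ × (Fin d → ℤ))} {b : ℤ × (Fin d → ℤ) → Rd d → ℝ}
    (h : CZData d COm Cc c₁ c₂ f lam Qset b) (hc₁ : 0 < c₁) (hlam : 0 < lam) (hCOm : 0 < COm)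
    (hf : Integrable f) {q : ℤ × (Fin d → ℤ)} (hq : q ∈ Qset) :
    volume (dcube d 0 q.1 q.2) ≤
      ENNReal.ofReal (c₁⁻¹ * lam⁻¹ * COm) * ∫⁻ x in dcube d 0 q.1 q.2, ‖f x‖ₑ := by
  have hv : (0:ℝ) < ((2:ℝ) ^ q.1) ^ d := by positivity
  have hav := h.avg_lower q hq
  have hint : ∫⁻ x in dcube d 0 q.1 q.2, ‖f x‖ₑ =
      ENNReal.ofReal (∫ x in dcube d 0 q.1 q.2, |f x|) := by
    simpa using (ofReal_integral_norm_eq_lintegral_enorm hf.integrableOn.integrable).symm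
  rw [hint, ← ENNReal.ofReal_mul (by positivity), volume_dcube]
  rw [volume_dcube, ENNReal.toReal_ofReal hv.le, le_div_iff₀ hv] at hav
  refine ENNReal.ofReal_le_ofReal ?_
  calc ((2:ℝ) ^ q.1) ^ d
      = c₁⁻¹ * lam⁻¹ * COm * (c₁ * lam / COm * ((2:ℝ) ^ q.1) ^ d) := by field_simp
    _ ≤ _ := by gcongr

/-- Uniform estimate: `Σ_{b_{k-s}χ_{½K} ≠ 0} |K| ≲ 2^{ds} λ^{-1} C_Ω ‖f‖_{L¹}`. -/
theorem total_measure_estimate :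
    ∀ d : ℕ, 2 ≤ d →
    ∀ Cc c₁ c₂ : ℝ, 0 < Cc → 0 < c₁ → 0 < c₂ →
    ∃ C' : ℝ, 0 < C' ∧
      ∀ COm : ℝ, 0 < COm →
      ∀ f : Rd d → ℝ, Integrable f →
      ∀ lam : ℝ, 0 < lam →
      ∀ (Qset : Set (ℤ × (Fin d → ℤ))) (b : ℤ × (Fin d → ℤ) → Rd d → ℝ),
        CZData d COm Cc c₁ c₂ f lam Qset b →
      ∀ s : ℕ, 200 ≤ s →
      ∀ w : Fin d → ℝ, GridShift d w →
        (∑' K : {km : ℤ × (Fin d → ℤ) //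
            ¬ ((dhalf d w km.1 km.2).indicator (bsum d Qset b (km.1 - (s : ℤ)))
                =ᵐ[(volume : Measure (Rd d))] (fun _ => (0:ℝ)))},
          volume (dcube d w K.1.1 K.1.2)) ≤
        ENNReal.ofReal (C' * (2:ℝ) ^ (d * s) * lam⁻¹ * COm * ∫ x : Rd d, |f x|) := by
  intro d _ Cc c₁ c₂ _ hc₁ _
  refine ⟨c₁⁻¹, by positivity, ?_⟩
  intro COm hCOm f hf lam hlam Qset b h s hs w _
  choose n hn hne using fun K : {km : ℤ × (Fin d → ℤ) //
      ¬ ((dhalf d w km.1 km.2).indicator (bsum d Qset b (km.1 - (s : ℤ)))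
        =ᵐ[(volume : Measure (Rd d))] (fun _ => (0:ℝ)))} => exists_mem_dcube_inter_dhalf h K.2
  have hdisj : Pairwise (Function.onFun Disjoint fun K => dcube d 0 (K.1.1 - (s : ℤ)) (n K)) := by
    intro K K' hKK
    refine h.pairwise_disjoint (hn K) (hn K') fun heq => hKK ?_
    obtain ⟨h1, h2⟩ := Prod.mk.inj heq
    have hk : K.1.1 = K'.1.1 := by linarith
    have hm := hne K'
    rw [← hk, ← h2] at hm
    exact Subtype.ext (Prod.ext hk (eq_of_dcube_inter_dhalf_nonempty (by omega) (hne K) hm))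
  have hvol : ∀ k : ℤ, ((2:ℝ) ^ k) ^ d = (2:ℝ) ^ (d * s) * ((2:ℝ) ^ (k - (s : ℤ))) ^ d := by
    intro k
    rw [mul_comm d s, pow_mul, ← mul_pow, ← zpow_natCast (2:ℝ) s, ← zpow_add₀ two_ne_zero,
      add_sub_cancel]
  have hint : ∫⁻ x, ‖f x‖ₑ = ENNReal.ofReal (∫ x, |f x|) := by
    simpa using (ofReal_integral_norm_eq_lintegral_enorm hf).symm
  calc _ ≤ ∑' K, ENNReal.ofReal ((2:ℝ) ^ (d * s)) * (ENNReal.ofReal (c₁⁻¹ * lam⁻¹ * COm) *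
        ∫⁻ x in dcube d 0 (K.1.1 - (s : ℤ)) (n K), ‖f x‖ₑ) := by
        refine ENNReal.tsum_le_tsum fun K => ?_
        rw [volume_dcube, hvol, ENNReal.ofReal_mul (by positivity), ← volume_dcube d 0 _ (n K)]
        gcongr
        exact volume_dcube_le_lintegral h hc₁ hlam hCOm hf (hn K)
    _ = ENNReal.ofReal ((2:ℝ) ^ (d * s)) * (ENNReal.ofReal (c₁⁻¹ * lam⁻¹ * COm) *
        ∫⁻ x in ⋃ K, dcube d 0 (K.1.1 - (s : ℤ)) (n K), ‖f x‖ₑ) := by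
        rw [ENNReal.tsum_mul_left, ENNReal.tsum_mul_left,
          lintegral_iUnion (fun _ => measurableSet_dcube _ _ _ _) hdisj]
    _ ≤ ENNReal.ofReal ((2:ℝ) ^ (d * s)) * (ENNReal.ofReal (c₁⁻¹ * lam⁻¹ * COm) *
        ∫⁻ x, ‖f x‖ₑ) := by
        gcongr
        exact Measure.restrict_le_self
    _ = _ := by
        rw [hint, ← ENNReal.ofReal_mul (by positivity), ← ENNReal.ofReal_mul (by positivity)]
        congr 1
        ring
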